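/- Let Θ be a continuous ellipsoid cover of ℝⁿ and ρ_Θ its induced quasi-distance. Define the non-symmetric function ρ₁(x,y) := inf{|θ_{x,t}| : t ∈ ℝ, y ∈ θ_{x,t}}. Then ρ_Θ(x,y) ≤ ρ₁(x,y) for all x, y, and there exists a constant C > 0, independent of x and y, such that ρ₁(x,y) ≤ C ρ_Θ(x,y) for all x, y ∈ ℝⁿ. -/

import Mathlib

open MeasureTheory Metric Set Filter ENNReal
noncomputable section

abbrev Euc (n : ℕ) : Type := EuclideanSpace ℝ (Fin n)

structure EllipsoidCover (n : ℕ) where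
  M : Euc n → ℝ → (Euc n ≃L[ℝ] Euc n)
  a₁ : ℝ
  a₂ : ℝ
  a₃ : ℝ
  a₄ : ℝ
  a₅ : ℝ
  a₆ : ℝ
  ha₁ : 0 < a₁
  ha₂ : 0 < a₂
  ha₃ : 0 < a₃
  ha₄ : 0 < a₄
  ha₅ : 0 < a₅
  ha₆ : 0 < a₆
  volume_lb : ∀ (x : Euc n) (t : ℝ),
    a₁ * 2 ^ (-t) ≤ (volume ((fun y => M x t y + x) '' ball 0 1)).toReal
  volume_ub : ∀ (x : Euc n) (t : ℝ),
    (volume ((fun y => M x t y + x) '' ball 0 1)).toReal ≤ a₂ * 2 ^ (-t)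
  shape : ∀ (x y : Euc n) (t s : ℝ), 0 ≤ s →
    (((fun v => M x t v + x) '' ball 0 1) ∩ ((fun v => M y (t + s) v + y) '' ball 0 1)).Nonempty →
    a₃ * 2 ^ (-(a₄ * s)) ≤
        1 / ‖((M y (t + s)).symm : Euc n →L[ℝ] Euc n).comp (M x t : Euc n →L[ℝ] Euc n)‖ ∧
    1 / ‖((M y (t + s)).symm : Euc n →L[ℝ] Euc n).comp (M x t : Euc n →L[ℝ] Euc n)‖ ≤
        ‖((M x t).symm : Euc n →L[ℝ] Euc n).comp (M y (t + s) : Euc n →L[ℝ] Euc n)‖ ∧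
    ‖((M x t).symm : Euc n →L[ℝ] Euc n).comp (M y (t + s) : Euc n →L[ℝ] Euc n)‖ ≤
        a₅ * 2 ^ (-(a₆ * s))

namespace EllipsoidCover

variable {n : ℕ}

def θ (Θ : EllipsoidCover n) (x : Euc n) (t : ℝ) : Set (Euc n) :=
  (fun y => Θ.M x t y + x) '' ball 0 1

def dil (Θ : EllipsoidCover n) (x : Euc n) (t : ℝ) (lam : ℝ) : Set (Euc n) :=
  (fun y => lam • (Θ.M x t y) + x) '' ball 0 1

def ρ (Θ : EllipsoidCover n) (x y : Euc n) : ℝ :=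
  sInf {r : ℝ | ∃ (z : Euc n) (t : ℝ), x ∈ Θ.θ z t ∧ y ∈ Θ.θ z t ∧ r = (volume (Θ.θ z t)).toReal}

end EllipsoidCover

/-- The non-symmetric variant `ρ₁(x,y) := inf {|θ_{x,t}| : t ∈ ℝ, y ∈ θ_{x,t}}`. -/
def EllipsoidCover.ρ₁ {n : ℕ} (Θ : EllipsoidCover n) (x y : Euc n) : ℝ :=
  sInf {r : ℝ | ∃ t : ℝ, y ∈ Θ.θ x t ∧ r = (volume (Θ.θ x t)).toReal}

namespace EllipsoidCover

variable {n : ℕ}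

theorem self_mem_θ (Θ : EllipsoidCover n) (x : Euc n) (t : ℝ) : x ∈ Θ.θ x t :=
  ⟨0, by simp, by simp⟩

/-- Enlarging the scale by a fixed amount `s`, the ellipsoid centred at a point `x` of `θ_{z,t}`
absorbs the translate to `x` of the `R`-dilate of `θ_{z,t}`. -/
theorem exists_scale_absorbing (Θ : EllipsoidCover n) (R : ℝ) :
    ∃ s : ℝ, 0 ≤ s ∧ ∀ (x z : Euc n) (t : ℝ) (w : Euc n), x ∈ Θ.θ z t → ‖w‖ ≤ R →
      Θ.M z t w + x ∈ Θ.θ x (t - s) := by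
  have hlim : Tendsto (fun s : ℝ => Θ.a₅ * (2 : ℝ) ^ (-(Θ.a₆ * s)) * R) atTop (nhds 0) := by
    have h₁ : Tendsto (fun s : ℝ => -(Θ.a₆ * s)) atTop atBot :=
      tendsto_neg_atTop_atBot.comp (tendsto_id.const_mul_atTop Θ.ha₆)
    have h₂ := (tendsto_rpow_atBot_of_base_gt_one 2 one_lt_two).comp h₁
    simpa using (h₂.const_mul Θ.a₅).mul_const R
  obtain ⟨s, hs, hs₀⟩ := ((hlim.eventually_lt_const one_pos).and (eventually_ge_atTop 0)).exists
  refine ⟨s, hs₀, fun x z t w hx hw => ?_⟩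
  have hshape := (Θ.shape x z (t - s) s hs₀
    ⟨x, Θ.self_mem_θ x (t - s), by rw [sub_add_cancel]; exact hx⟩).2.2
  rw [sub_add_cancel] at hshape
  refine ⟨(Θ.M x (t - s)).symm (Θ.M z t w), ?_, by simp⟩
  rw [mem_ball_zero_iff]
  have hle := ContinuousLinearMap.le_of_opNorm_le_of_le _ hshape hw
  exact lt_of_le_of_lt hle hs

theorem exists_mem_θ (Θ : EllipsoidCover n) (x y : Euc n) : ∃ t : ℝ, y ∈ Θ.θ x t := by
  obtain ⟨s, -, h⟩ := Θ.exists_scale_absorbing ‖(Θ.M x 0).symm (y - x)‖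
  exact ⟨0 - s, by simpa using h x x 0 _ (Θ.self_mem_θ x 0) le_rfl⟩

theorem ρ_le (Θ : EllipsoidCover n) {x y z : Euc n} {t : ℝ} (hx : x ∈ Θ.θ z t)
    (hy : y ∈ Θ.θ z t) : Θ.ρ x y ≤ (volume (Θ.θ z t)).toReal :=
  csInf_le ⟨0, by rintro _ ⟨_, _, _, _, rfl⟩; exact toReal_nonneg⟩ ⟨z, t, hx, hy, rfl⟩

theorem ρ₁_le (Θ : EllipsoidCover n) {x y : Euc n} {t : ℝ} (hy : y ∈ Θ.θ x t) :
    Θ.ρ₁ x y ≤ (volume (Θ.θ x t)).toReal :=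
  csInf_le ⟨0, by rintro _ ⟨_, _, rfl⟩; exact toReal_nonneg⟩ ⟨t, hy, rfl⟩

theorem ρ_le_ρ₁ (Θ : EllipsoidCover n) (x y : Euc n) : Θ.ρ x y ≤ Θ.ρ₁ x y := by
  obtain ⟨t, ht⟩ := Θ.exists_mem_θ x y
  refine le_csInf ⟨_, t, ht, rfl⟩ ?_
  rintro _ ⟨t, ht, rfl⟩
  exact Θ.ρ_le (Θ.self_mem_θ x t) ht

theorem volume_θ_sub_le (Θ : EllipsoidCover n) (x z : Euc n) (t s : ℝ) :
    (volume (Θ.θ x (t - s))).toReal ≤ Θ.a₂ / Θ.a₁ * 2 ^ s * (volume (Θ.θ z t)).toReal := by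
  have h₁ := Θ.ha₁
  have h₂ := Θ.ha₂
  calc (volume (Θ.θ x (t - s))).toReal ≤ Θ.a₂ * 2 ^ (-(t - s)) := Θ.volume_ub x (t - s)
    _ = Θ.a₂ / Θ.a₁ * 2 ^ s * (Θ.a₁ * 2 ^ (-t)) := by
      rw [show -(t - s) = s + -t by ring, Real.rpow_add two_pos]
      field_simp
    _ ≤ Θ.a₂ / Θ.a₁ * 2 ^ s * (volume (Θ.θ z t)).toReal := by
      gcongr
      exact Θ.volume_lb z t

theorem exists_ρ₁_le_mul_ρ (Θ : EllipsoidCover n) :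
    ∃ C : ℝ, 0 < C ∧ ∀ x y : Euc n, Θ.ρ₁ x y ≤ C * Θ.ρ x y := by
  obtain ⟨s, -, hs⟩ := Θ.exists_scale_absorbing 2
  have hC : 0 < Θ.a₂ / Θ.a₁ * (2 : ℝ) ^ s :=
    mul_pos (div_pos Θ.ha₂ Θ.ha₁) (Real.rpow_pos_of_pos two_pos s)
  refine ⟨_, hC, fun x y => ?_⟩
  rw [← div_le_iff₀' hC]
  obtain ⟨t₀, ht₀⟩ := Θ.exists_mem_θ x y
  refine le_csInf ⟨_, x, t₀, Θ.self_mem_θ x t₀, ht₀, rfl⟩ ?_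
  rintro _ ⟨z, t, hx, hy, rfl⟩
  rw [div_le_iff₀' hC]
  refine le_trans (Θ.ρ₁_le ?_) (Θ.volume_θ_sub_le x z t s)
  obtain ⟨u, hu, hux⟩ := id hx
  obtain ⟨v, hv, hvy⟩ := hy
  rw [mem_ball_zero_iff] at hu hv
  have hw : ‖v - u‖ ≤ 2 := by linarith [norm_sub_le v u]
  convert hs x z t (v - u) hx hw using 1
  simp only [map_sub, ← hux, ← hvy]
  abel

end EllipsoidCover

/-- For a continuous ellipsoid cover `Θ`, the non-symmetric function
`ρ₁` is equivalent to the quasi-distance `ρ_Θ`: one always has `ρ_Θ(x,y) ≤ ρ₁(x,y)`, and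
there is a constant `C > 0`, independent of `x,y`, with `ρ₁(x,y) ≤ C ρ_Θ(x,y)`. -/
theorem stmt5 (n : ℕ) (Θ : EllipsoidCover n) :
    (∀ x y : Euc n, Θ.ρ x y ≤ Θ.ρ₁ x y) ∧
    ∃ C : ℝ, 0 < C ∧ ∀ x y : Euc n, Θ.ρ₁ x y ≤ C * Θ.ρ x y :=
  ⟨Θ.ρ_le_ρ₁, Θ.exists_ρ₁_le_mul_ρ⟩
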